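/- arXiv:0909.4778 — 6 statements merged into one kernel-verified Lean document; each statement's English description precedes it below -/
import Mathlib

section
/- A finite bounded graded poset P is a lattice if and only if P contains no bowtie. -/
/-- `m` is a minimal upper bound of `b` and `d`. -/
def IsMinimalUpperBoundOf {P : Type*} [PartialOrder P] (m b d : P) : Prop :=
  b ≤ m ∧ d ≤ m ∧ ∀ z, b ≤ z → d ≤ z → z ≤ m → z = m

/-- `m` is a maximal lower bound of `a` and `c`. -/
def IsMaximalLowerBoundOf {P : Type*} [PartialOrder P] (m a c : P) : Prop :=
  m ≤ a ∧ m ≤ c ∧ ∀ z, z ≤ a → z ≤ c → m ≤ z → z = m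

/-- A poset contains a bowtie if there are four distinct elements `a`, `b`, `c`, `d`
such that `a` and `c` are both minimal upper bounds of `b` and `d`, and `b` and `d`
are both maximal lower bounds of `a` and `c`. -/
def HasBowtie (P : Type*) [PartialOrder P] : Prop :=
  ∃ a b c d : P, a ≠ b ∧ a ≠ c ∧ a ≠ d ∧ b ≠ c ∧ b ≠ d ∧ c ≠ d ∧
    IsMinimalUpperBoundOf a b d ∧ IsMinimalUpperBoundOf c b d ∧
    IsMaximalLowerBoundOf b a c ∧ IsMaximalLowerBoundOf d a c

theorem exists_isMinimalUpperBoundOf_le {P : Type*} [PartialOrder P] [Finite P] {x y u : P}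
    (hx : x ≤ u) (hy : y ≤ u) : ∃ m ≤ u, IsMinimalUpperBoundOf m x y := by
  obtain ⟨m, hmu, hm⟩ :=
    (Set.toFinite {z : P | x ≤ z ∧ y ≤ z}).exists_le_minimal (a := u) ⟨hx, hy⟩
  exact ⟨m, hmu, hm.prop.1, hm.prop.2,
    fun z hxz hyz hzm => le_antisymm hzm (hm.le_of_le ⟨hxz, hyz⟩ hzm)⟩

theorem exists_isMaximalLowerBoundOf_ge {P : Type*} [PartialOrder P] [Finite P] {x y l : P}
    (hx : l ≤ x) (hy : l ≤ y) : ∃ m, l ≤ m ∧ IsMaximalLowerBoundOf m x y := by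
  obtain ⟨m, hlm, hm⟩ :=
    (Set.toFinite {z : P | z ≤ x ∧ z ≤ y}).exists_le_maximal (a := l) ⟨hx, hy⟩
  exact ⟨m, hlm, hm.prop.1, hm.prop.2,
    fun z hzx hzy hmz => le_antisymm (hm.le_of_ge ⟨hzx, hzy⟩ hmz) hmz⟩

/-- Replacing `b` and `d` by maximal lower bounds of `a` and `c` above them turns two distinct
minimal upper bounds `a` and `c` of `b` and `d` into a bowtie. -/
theorem IsMinimalUpperBoundOf.eq_of_not_hasBowtie {P : Type*} [PartialOrder P] [Finite P]
    (h : ¬ HasBowtie P) {a c b d : P} (ha : IsMinimalUpperBoundOf a b d)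
    (hc : IsMinimalUpperBoundOf c b d) : a = c := by
  by_contra hac
  obtain ⟨hba, hda, ha⟩ := ha
  obtain ⟨hbc, hdc, hc⟩ := hc
  obtain ⟨b', hb, hb'⟩ := exists_isMaximalLowerBoundOf_ge hba hbc
  obtain ⟨d', hd, hd'⟩ := exists_isMaximalLowerBoundOf_ge hda hdc
  have not_le_ac : ¬ a ≤ c := fun hle => hac (hc a hba hda hle)
  have not_le_ca : ¬ c ≤ a := fun hle => hac (ha c hbc hdc hle).symm
  refine h ⟨a, b', c, d', ?_, hac, ?_, ?_, ?_, ?_,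
    ⟨hb'.1, hd'.1, fun z hbz hdz => ha z (hb.trans hbz) (hd.trans hdz)⟩,
    ⟨hb'.2.1, hd'.2.1, fun z hbz hdz => hc z (hb.trans hbz) (hd.trans hdz)⟩, hb', hd'⟩
  · rintro rfl
    exact not_le_ac hb'.2.1
  · rintro rfl
    exact not_le_ac hd'.2.1
  · rintro rfl
    exact not_le_ca hb'.1
  · rintro rfl
    exact hac ((ha b' hb hd hb'.1).symm.trans (hc b' hb hd hb'.2.1))
  · rintro rfl
    exact not_le_ca hd'.1

theorem IsMaximalLowerBoundOf.eq_of_not_hasBowtie {P : Type*} [PartialOrder P] [Finite P]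
    (h : ¬ HasBowtie P) {b d a c : P} (hb : IsMaximalLowerBoundOf b a c)
    (hd : IsMaximalLowerBoundOf d a c) : b = d := by
  obtain ⟨m, hma, hm⟩ := exists_isMinimalUpperBoundOf_le hb.1 hd.1
  obtain ⟨m', hmc, hm'⟩ := exists_isMinimalUpperBoundOf_le hb.2.1 hd.2.1
  obtain rfl := hm.eq_of_not_hasBowtie h hm'
  exact (hb.2.2 m hma hmc hm.1).symm.trans (hd.2.2 m hma hmc hm.2.1)

/-- A finite bounded graded poset is a lattice (every pair of elements has a unique
minimal upper bound and a unique maximal lower bound) iff it contains no bowtie. -/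
theorem lattice_iff_no_bowtie {P : Type*} [PartialOrder P] [BoundedOrder P] [Fintype P]
    (n : ℕ) (ρ : P → ℕ) (hbot : ρ ⊥ = 0) (htop : ρ ⊤ = n)
    (hcov : ∀ a b : P, a ⋖ b → ρ b = ρ a + 1) :
    (∀ x y : P, (∃! m, IsMinimalUpperBoundOf m x y) ∧
      (∃! m, IsMaximalLowerBoundOf m x y)) ↔ ¬ HasBowtie P := by
  constructor
  · rintro h ⟨a, b, c, d, -, hac, -, -, -, -, ha, hc, -, -⟩
    exact hac ((h b d).1.unique ha hc)
  · intro h x y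
    obtain ⟨m, -, hm⟩ := exists_isMinimalUpperBoundOf_le (le_top (a := x)) (le_top (a := y))
    obtain ⟨l, -, hl⟩ := exists_isMaximalLowerBoundOf_ge (bot_le (a := x)) (bot_le (a := y))
    exact ⟨⟨m, hm, fun _ hz => hz.eq_of_not_hasBowtie h hm⟩,
      ⟨l, hl, fun _ hz => hz.eq_of_not_hasBowtie h hl⟩⟩
end

section
/- Every global spindle in the lattice of all subsets of a finite set S has girth exactly 6. Moreover, if the spindle x_1, …, x_{2k} is indexed so that x_1 ⊆ x_2, then the sets A = x_1, B = x_3, C = x_5 are nonempty, pairwise disjoint, satisfy A ∪ B ∪ C = S, and x_2 = A ∪ B, x_4 = B ∪ C, x_6 = C ∪ A. -/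
/-- `x` and `y` are complements in the interval `[z, w]`. -/
def ComplementsIn {P : Type*} [PartialOrder P] (z w x y : P) : Prop :=
  z ≤ x ∧ x ≤ w ∧ z ≤ y ∧ y ≤ w ∧
  (∀ u, z ≤ u → u ≤ w → x ≤ u → y ≤ u → u = w) ∧
  (∀ u, z ≤ u → u ≤ w → u ≤ x → u ≤ y → u = z)

/-- A spindle of girth `2k` in the interval `[z, w]` (see the paper): a `2k`-periodic
sequence of elements of the interval, distinct over one period and distinct from the
endpoints, whose alternate members are complements in the appropriate subintervals. -/
def IsSpindleIn {P : Type*} [PartialOrder P] (z w : P) (k : ℕ) (x : ℤ → P) : Prop :=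
  2 ≤ k ∧
  (∀ i : ℤ, x (i + 2 * k) = x i) ∧
  (∀ i j : ℤ, 0 ≤ i → i < 2 * k → 0 ≤ j → j < 2 * k → x i = x j → i = j) ∧
  (∀ i : ℤ, z ≤ x i ∧ x i ≤ w ∧ x i ≠ z ∧ x i ≠ w) ∧
  (((∀ i : ℤ, Even i → ComplementsIn z (x i) (x (i - 1)) (x (i + 1))) ∧
    (∀ i : ℤ, Odd i → ComplementsIn (x i) w (x (i - 1)) (x (i + 1)))) ∨
   ((∀ i : ℤ, Odd i → ComplementsIn z (x i) (x (i - 1)) (x (i + 1))) ∧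
    (∀ i : ℤ, Even i → ComplementsIn (x i) w (x (i - 1)) (x (i + 1)))))

/-- In a lattice, complements in `[z, w]` have join `w` and meet `z`. -/
theorem ComplementsIn.sup_eq_and_inf_eq {P : Type*} [Lattice P] {z w x y : P}
    (h : ComplementsIn z w x y) : x ⊔ y = w ∧ x ⊓ y = z := by
  obtain ⟨hzx, hxw, hzy, hyw, hsup, hinf⟩ := h
  exact ⟨hsup _ (hzx.trans le_sup_left) (sup_le hxw hyw) le_sup_left le_sup_right,
    hinf _ (le_inf hzx hzy) (inf_le_left.trans hxw) inf_le_left inf_le_right⟩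

/-- A sequence of sets in which the members of index `2 j + c` are the disjoint unions of their
neighbours, and the others are the intersections of their neighbours, which cover everything.
Three consecutive members of the latter kind partition the ground set. -/
theorem alternating_complements_partition {S : Type*} [Fintype S] [DecidableEq S]
    {x : ℤ → Finset S} {c : ℤ}
    (hpeak : ∀ j : ℤ, ComplementsIn ∅ (x (2 * j + c)) (x (2 * j + c - 1)) (x (2 * j + c + 1)))
    (hvalley : ∀ j : ℤ, ComplementsIn (x (2 * j + c + 1)) Finset.univ
      (x (2 * j + c + 1 - 1)) (x (2 * j + c + 1 + 1))) (j : ℤ) :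
    x (2 * j + c) = x (2 * j + c - 1) ∪ x (2 * j + c + 1) ∧
    Disjoint (x (2 * j + c - 1)) (x (2 * j + c + 1)) ∧
    Disjoint (x (2 * j + c - 1)) (x (2 * j + c + 3)) ∧
    x (2 * j + c - 1) ∪ x (2 * j + c + 1) ∪ x (2 * j + c + 3) = Finset.univ := by
  obtain ⟨p, q⟩ := (hpeak j).sup_eq_and_inf_eq
  obtain ⟨p', q'⟩ := (hpeak (j + 1)).sup_eq_and_inf_eq
  obtain ⟨r, s⟩ := (hvalley j).sup_eq_and_inf_eq
  rw [show 2 * (j + 1) + c - 1 = 2 * j + c + 1 by ring,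
    show 2 * (j + 1) + c + 1 = 2 * j + c + 3 by ring] at p' q'
  rw [show 2 * (j + 1) + c = 2 * j + c + 2 by ring] at p'
  rw [show 2 * j + c + 1 - 1 = 2 * j + c by ring,
    show 2 * j + c + 1 + 1 = 2 * j + c + 2 by ring] at r s
  generalize x (2 * j + c) = P at *
  generalize x (2 * j + c - 1) = A at *
  generalize x (2 * j + c + 1) = B at *
  generalize x (2 * j + c + 2) = Q at *
  generalize x (2 * j + c + 3) = C at *
  simp only [Finset.sup_eq_union, Finset.inf_eq_inter, Finset.ext_iff, Finset.mem_union,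
    Finset.mem_inter, Finset.mem_univ, Finset.notMem_empty, iff_true, iff_false,
    Finset.disjoint_left] at *
  grind

theorem alternating_complements_periodic {S : Type*} [Fintype S] [DecidableEq S]
    {x : ℤ → Finset S} {c : ℤ}
    (hpeak : ∀ j : ℤ, ComplementsIn ∅ (x (2 * j + c)) (x (2 * j + c - 1)) (x (2 * j + c + 1)))
    (hvalley : ∀ j : ℤ, ComplementsIn (x (2 * j + c + 1)) Finset.univ
      (x (2 * j + c + 1 - 1)) (x (2 * j + c + 1 + 1))) (i : ℤ) :
    x (i + 6) = x i := by
  have key := alternating_complements_partition hpeak hvalley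
  have hodd (j : ℤ) : x (2 * j + c + 5) = x (2 * j + c - 1) := by
    obtain ⟨-, h₁, h₂, h₃⟩ := key j
    obtain ⟨-, k₁, k₂, k₃⟩ := key (j + 1)
    obtain ⟨-, l₁, -, -⟩ := key (j + 2)
    rw [show 2 * (j + 1) + c - 1 = 2 * j + c + 1 by ring,
      show 2 * (j + 1) + c + 3 = 2 * j + c + 5 by ring] at k₂ k₃
    rw [show 2 * (j + 1) + c - 1 = 2 * j + c + 1 by ring] at k₁
    rw [show 2 * (j + 1) + c + 1 = 2 * j + c + 3 by ring] at k₁ k₃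
    rw [show 2 * (j + 2) + c - 1 = 2 * j + c + 3 by ring,
      show 2 * (j + 2) + c + 1 = 2 * j + c + 5 by ring] at l₁
    clear key
    generalize x (2 * j + c - 1) = A at *
    generalize x (2 * j + c + 1) = B at *
    generalize x (2 * j + c + 3) = C at *
    generalize x (2 * j + c + 5) = D at *
    simp only [Finset.ext_iff, Finset.mem_union, Finset.mem_univ, iff_true,
      Finset.disjoint_left] at *
    grind
  obtain ⟨j, hj | hj⟩ : ∃ j : ℤ, i = 2 * j + c ∨ i = 2 * j + c - 1 :=
    ⟨(i - c + 1) / 2, by omega⟩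
  · have h₁ := hodd j
    have h₂ := hodd (j + 1)
    have h₃ := (key (j + 3)).1
    rw [show 2 * (j + 3) + c - 1 = 2 * j + c + 5 by ring,
      show 2 * (j + 3) + c + 1 = 2 * (j + 1) + c + 5 by ring, h₁, h₂,
      show 2 * (j + 1) + c - 1 = 2 * j + c + 1 by ring, ← (key j).1] at h₃
    rw [hj, ← h₃]
    ring_nf
  · rw [hj, ← hodd j]
    ring_nf

/-- Every global spindle in the boolean lattice of all subsets of a finite set `S` has
girth exactly `6`; moreover if it is indexed so that `x 0 ⊆ x 1` then the sets
`A = x 0`, `B = x 2`, `C = x 4` are nonempty, pairwise disjoint, their union is `S`,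
and `x 1 = A ∪ B`, `x 3 = B ∪ C`, `x 5 = C ∪ A`. -/
theorem boolean_spindle_girth_six {S : Type*} [Fintype S] [DecidableEq S]
    (k : ℕ) (x : ℤ → Finset S)
    (hx : IsSpindleIn (∅ : Finset S) Finset.univ k x) :
    k = 3 ∧
    (x 0 ⊆ x 1 →
      x 0 ≠ ∅ ∧ x 2 ≠ ∅ ∧ x 4 ≠ ∅ ∧
      Disjoint (x 0) (x 2) ∧ Disjoint (x 2) (x 4) ∧ Disjoint (x 0) (x 4) ∧
      x 0 ∪ x 2 ∪ x 4 = Finset.univ ∧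
      x 1 = x 0 ∪ x 2 ∧ x 3 = x 2 ∪ x 4 ∧ x 5 = x 4 ∪ x 0) := by
  obtain ⟨hk, hper, hinj, hends, hcases⟩ := hx
  obtain ⟨c, hc, hpeak, hvalley⟩ : ∃ c : ℤ, (c = 0 ∨ c = 1) ∧
      (∀ j : ℤ, ComplementsIn ∅ (x (2 * j + c)) (x (2 * j + c - 1)) (x (2 * j + c + 1))) ∧
      (∀ j : ℤ, ComplementsIn (x (2 * j + c + 1)) Finset.univ
        (x (2 * j + c + 1 - 1)) (x (2 * j + c + 1 + 1))) := by
    rcases hcases with ⟨hp, hv⟩ | ⟨hp, hv⟩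
    · exact ⟨0, Or.inl rfl, fun j => hp _ ⟨j, by ring⟩, fun j => hv _ ⟨j, by ring⟩⟩
    · exact ⟨1, Or.inr rfl, fun j => hp _ ⟨j, by ring⟩, fun j => hv _ ⟨j + 1, by ring⟩⟩
  have hsix := alternating_complements_periodic hpeak hvalley
  have hk3 : k = 3 := by
    rcases lt_trichotomy k 3 with h | h | h
    · obtain rfl : k = 2 := by omega
      have h₀ : x 6 = x 0 := hsix 0
      have h₂ : x 6 = x 2 := hper 2
      have := hinj 0 2 (by norm_num) (by norm_num) (by norm_num) (by norm_num) (h₀.symm.trans h₂)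
      omega
    · exact h
    · have := hinj 6 0 (by norm_num) (by omega) (by norm_num) (by omega) (hsix 0)
      omega
  refine ⟨hk3, fun h01 => ?_⟩
  have key := alternating_complements_partition hpeak hvalley
  rcases hc with rfl | rfl
  · have h10 : x 1 ⊆ x 0 := (hvalley 0).1
    have := hinj 0 1 (by norm_num) (by omega) (by norm_num) (by omega) (h01.antisymm h10)
    omega
  · obtain ⟨h₁, d₀₂, d₀₄, hU⟩ := key 0
    obtain ⟨h₃, d₂₄, -, -⟩ := key 1
    obtain ⟨h₅, -, -, -⟩ := key 2
    have h60 : x 6 = x 0 := hsix 0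
    norm_num at h₁ d₀₂ d₀₄ hU h₃ d₂₄ h₅
    rw [h60] at h₅
    rw [← Finset.union_assoc] at hU
    exact ⟨(hends 0).2.2.1, (hends 2).2.2.1, (hends 4).2.2.1, d₀₂, d₂₄, d₀₄, hU, h₁, h₃, h₅⟩
end

section
/- Let P be a finite bounded graded lattice of rank n whose rank function ρ is modular, meaning ρ(x ∨ y) + ρ(x ∧ y) = ρ(x) + ρ(y) for all x, y ∈ P. Then every global spindle in P has girth at least 6 and length at least 2π. In particular, P has no short global spindles. -/
/-- The length, under the orthoscheme metric, of the edge of the diagonal link of a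
graded lattice of rank `n` joining the vertices of two comparable elements `a`, `b`:
for `a < b` it is `arccos √((ρ a · (n − ρ b)) / (ρ b · (n − ρ a)))`; the meet and join
are used to order the pair so that the smaller element comes first. -/
noncomputable def edgeLen {P : Type*} [Lattice P] (ρ : P → ℕ) (n : ℕ) (a b : P) : ℝ :=
  Real.arccos (Real.sqrt (((ρ (a ⊓ b) : ℝ) * ((n : ℝ) - (ρ (a ⊔ b) : ℝ))) /
    ((ρ (a ⊔ b) : ℝ) * ((n : ℝ) - (ρ (a ⊓ b) : ℝ)))))

/-- The length of a spindle of girth `2k`: the sum of the edge lengths over its `2k`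
cyclically consecutive pairs. -/
noncomputable def spindleLength {P : Type*} [Lattice P] (ρ : P → ℕ) (n k : ℕ)
    (x : ℤ → P) : ℝ :=
  ∑ i ∈ Finset.range (2 * k), edgeLen ρ n (x (i : ℤ)) (x ((i : ℤ) + 1))

theorem ComplementsIn.sup_eq {P : Type*} [Lattice P] {z w x y : P}
    (h : ComplementsIn z w x y) : x ⊔ y = w := by
  obtain ⟨hzx, hxw, -, hyw, hsup, -⟩ := h
  exact hsup _ (hzx.trans le_sup_left) (sup_le hxw hyw) le_sup_left le_sup_right

theorem ComplementsIn.inf_eq {P : Type*} [Lattice P] {z w x y : P}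
    (h : ComplementsIn z w x y) : x ⊓ y = z := by
  obtain ⟨hzx, hxw, hzy, -, -, hinf⟩ := h
  exact hinf _ (le_inf hzx hzy) (inf_le_left.trans hxw) inf_le_left inf_le_right

theorem ComplementsIn.symm {P : Type*} [PartialOrder P] {z w x y : P}
    (h : ComplementsIn z w x y) : ComplementsIn z w y x := by
  obtain ⟨hzx, hxw, hzy, hyw, hsup, hinf⟩ := h
  exact ⟨hzy, hyw, hzx, hxw, fun u h₁ h₂ h₃ h₄ => hsup u h₁ h₂ h₄ h₃,
    fun u h₁ h₂ h₃ h₄ => hinf u h₁ h₂ h₄ h₃⟩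

theorem edgeLen_comm {P : Type*} [Lattice P] (ρ : P → ℕ) (n : ℕ) (a b : P) :
    edgeLen ρ n a b = edgeLen ρ n b a := by
  simp only [edgeLen, inf_comm a b, sup_comm a b]

theorem edgeLen_of_le {P : Type*} [Lattice P] (ρ : P → ℕ) (n : ℕ) {a b : P} (h : a ≤ b) :
    edgeLen ρ n a b = Real.arccos (Real.sqrt (((ρ a : ℝ) * ((n : ℝ) - (ρ b : ℝ))) /
      ((ρ b : ℝ) * ((n : ℝ) - (ρ a : ℝ))))) := by
  rw [edgeLen, inf_eq_left.2 h, sup_eq_right.2 h]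

theorem edgeLen_nonneg {P : Type*} [Lattice P] (ρ : P → ℕ) (n : ℕ) (a b : P) :
    0 ≤ edgeLen ρ n a b :=
  Real.arccos_nonneg _

theorem Real.arccos_sqrt_eq_arctan_sqrt {p q r : ℝ} (hp : 0 < p) (hq : 0 < q) (hr : 0 < r) :
    Real.arccos (√(p * r / ((p + q) * (q + r)))) = Real.arctan (√(q * (p + q + r) / (p * r))) := by
  rw [Real.arctan_eq_arccos (Real.sqrt_nonneg _), Real.sq_sqrt (by positivity), ← Real.sqrt_inv]
  congr 2
  field_simp
  ring

theorem Real.arctan_add_arctan_add_arctan_eq_pi {x y z : ℝ} (hx : 0 < x) (hxy : 1 < x * y)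
    (h : x + y + z = x * y * z) : Real.arctan x + Real.arctan y + Real.arctan z = Real.pi := by
  have hz : (x + y) / (1 - x * y) = -z := by
    rw [div_eq_iff (by linarith)]
    linarith
  rw [Real.arctan_add_eq_add_pi hxy hx, hz, Real.arctan_neg]
  ring

theorem Real.arctan_sqrt_sum_eq_pi {p q r : ℝ} (hp : 0 < p) (hq : 0 < q) (hr : 0 < r) :
    Real.arctan (√(p * (p + q + r) / (q * r))) + Real.arctan (√(q * (p + q + r) / (p * r))) +
      Real.arctan (√(r * (p + q + r) / (p * q))) = Real.pi := by
  have hp' : 0 < √p := Real.sqrt_pos.2 hp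
  have hq' : 0 < √q := Real.sqrt_pos.2 hq
  have hr' : 0 < √r := Real.sqrt_pos.2 hr
  have hn : 0 < p + q + r := by positivity
  have hn' : 0 < √(p + q + r) := Real.sqrt_pos.2 hn
  have hsq := Real.sq_sqrt hn.le
  have hsp := Real.sq_sqrt hp.le
  have hsq' := Real.sq_sqrt hq.le
  have hsr := Real.sq_sqrt hr.le
  rw [Real.sqrt_div (by positivity), Real.sqrt_div (by positivity), Real.sqrt_div (by positivity),
    Real.sqrt_mul hp.le, Real.sqrt_mul hq.le, Real.sqrt_mul hr.le, Real.sqrt_mul hq.le,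
    Real.sqrt_mul hp.le, Real.sqrt_mul hp.le]
  generalize √(p + q + r) = m at *
  generalize √p = a at *
  generalize √q = b at *
  generalize √r = c at *
  apply Real.arctan_add_arctan_add_arctan_eq_pi (by positivity)
  · have : a * m / (b * c) * (b * m / (a * c)) = m ^ 2 / c ^ 2 := by field_simp
    rw [this, one_lt_div (by positivity)]
    linarith
  · have : m ^ 2 = a ^ 2 + b ^ 2 + c ^ 2 := by linarith
    field_simp
    linarith

/-- Three consecutive edges of a spindle, starting at a lower element, have total length `π`. -/
theorem edgeLen_add_edgeLen_add_edgeLen_eq_pi {P : Type*} [Lattice P] [BoundedOrder P]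
    {n : ℕ} {ρ : P → ℕ} (hbot : ρ ⊥ = 0) (htop : ρ ⊤ = n) (hρ : StrictMono ρ)
    (hmod : ∀ a b : P, ρ (a ⊔ b) + ρ (a ⊓ b) = ρ a + ρ b) {a b c d : P}
    (ha : a ≠ ⊥) (hb : b ≠ ⊤) (hc : c ≠ ⊥)
    (hac : ComplementsIn ⊥ b a c) (hbd : ComplementsIn c ⊤ b d) :
    edgeLen ρ n a b + edgeLen ρ n b c + edgeLen ρ n c d = Real.pi := by
  have hp : 0 < ρ a := hbot ▸ hρ (bot_lt_iff_ne_bot.2 ha)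
  have hq : 0 < ρ c := hbot ▸ hρ (bot_lt_iff_ne_bot.2 hc)
  have hr : ρ b < n := htop ▸ hρ (lt_top_iff_ne_top.2 hb)
  have h₁ := hmod a c
  have h₂ := hmod b d
  rw [hac.sup_eq, hac.inf_eq, hbot, add_zero] at h₁
  rw [hbd.sup_eq, hbd.inf_eq, htop] at h₂
  obtain ⟨r, rfl⟩ := Nat.exists_eq_add_of_lt hr
  have hd : ρ d = ρ c + (r + 1) := by omega
  rw [edgeLen_comm ρ _ b c, edgeLen_of_le ρ _ hac.2.1, edgeLen_of_le ρ _ hac.2.2.2.1,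
    edgeLen_of_le ρ _ hbd.2.2.1, h₁, hd]
  have hp' : (0 : ℝ) < ρ a := by exact_mod_cast hp
  have hq' : (0 : ℝ) < ρ c := by exact_mod_cast hq
  have hr' : (0 : ℝ) < r + 1 := by positivity
  have key := Real.arctan_sqrt_sum_eq_pi hp' hq' hr'
  have e₁ := Real.arccos_sqrt_eq_arctan_sqrt hp' hq' hr'
  have e₂ := Real.arccos_sqrt_eq_arctan_sqrt hq' hp' hr'
  have e₃ := Real.arccos_sqrt_eq_arctan_sqrt hq' hr' hp'
  push_cast
  ring_nf at key e₁ e₂ e₃ ⊢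
  rw [← key, ← e₁, ← e₂, ← e₃]
  ring_nf

/-- In a finite bounded graded lattice with a modular rank function, every global
spindle has girth at least `6` and length at least `2π`; in particular there are no
short global spindles. -/
theorem modular_spindles_long {P : Type*} [Lattice P] [BoundedOrder P] [Fintype P]
    (n : ℕ) (ρ : P → ℕ) (hbot : ρ ⊥ = 0) (htop : ρ ⊤ = n)
    (hcov : ∀ a b : P, a ⋖ b → ρ b = ρ a + 1)
    (hmod : ∀ a b : P, ρ (a ⊔ b) + ρ (a ⊓ b) = ρ a + ρ b)
    (k : ℕ) (x : ℤ → P) (hx : IsSpindleIn (⊥ : P) ⊤ k x) :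
    3 ≤ k ∧ 2 * Real.pi ≤ spindleLength ρ n k x := by
  classical
  have hρ : StrictMono ρ := by
    let _ : LocallyFiniteOrder P := Fintype.toLocallyFiniteOrder
    exact (strictMono_iff_forall_covBy ρ).2 fun a b h => by rw [hcov a b h]; exact Nat.lt_succ_self _
  obtain ⟨hk2, hper, hinj, hne, hcomp⟩ := hx
  have hk : 3 ≤ k := by
    by_contra hlt
    obtain rfl : k = 2 := by omega
    have h4 : x 4 = x 0 := by simpa using hper 0
    have h13 : x 1 = x 3 := by
      rcases hcomp with ⟨-, h⟩ | ⟨h, -⟩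
      · have h₁ := (h 1 (by decide)).inf_eq
        have h₃ := (h 3 (by decide)).inf_eq
        norm_num [h4] at h₁ h₃
        rw [← h₁, ← h₃, inf_comm]
      · have h₁ := (h 1 (by decide)).sup_eq
        have h₃ := (h 3 (by decide)).sup_eq
        norm_num [h4] at h₁ h₃
        rw [← h₁, ← h₃, sup_comm]
    have := hinj 1 3 (by norm_num) (by norm_num) (by norm_num) (by norm_num) h13
    omega
  refine ⟨hk, ?_⟩
  have key : ∀ i : ℤ, edgeLen ρ n (x i) (x (i + 1)) + edgeLen ρ n (x (i + 1)) (x (i + 2)) +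
      edgeLen ρ n (x (i + 2)) (x (i + 3)) = Real.pi := by
    intro i
    have up : ComplementsIn ⊥ (x (i + 1)) (x i) (x (i + 2)) →
        ComplementsIn (x (i + 2)) ⊤ (x (i + 1)) (x (i + 3)) →
        edgeLen ρ n (x i) (x (i + 1)) + edgeLen ρ n (x (i + 1)) (x (i + 2)) +
          edgeLen ρ n (x (i + 2)) (x (i + 3)) = Real.pi :=
      edgeLen_add_edgeLen_add_edgeLen_eq_pi hbot htop hρ hmod
        (hne i).2.2.1 (hne (i + 1)).2.2.2 (hne (i + 2)).2.2.1
    have down : ComplementsIn (x (i + 1)) ⊤ (x i) (x (i + 2)) →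
        ComplementsIn ⊥ (x (i + 2)) (x (i + 1)) (x (i + 3)) →
        edgeLen ρ n (x i) (x (i + 1)) + edgeLen ρ n (x (i + 1)) (x (i + 2)) +
          edgeLen ρ n (x (i + 2)) (x (i + 3)) = Real.pi := by
      intro h₁ h₂
      have := edgeLen_add_edgeLen_add_edgeLen_eq_pi hbot htop hρ hmod
        (hne (i + 3)).2.2.1 (hne (i + 2)).2.2.2 (hne (i + 1)).2.2.1 h₂.symm h₁.symm
      rw [edgeLen_comm ρ n (x i), edgeLen_comm ρ n (x (i + 1)) (x (i + 2)),
        edgeLen_comm ρ n (x (i + 2)) (x (i + 3))]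
      linarith
    have i₁ : i + 1 - 1 = i := by ring
    have i₂ : i + 1 + 1 = i + 2 := by ring
    have i₃ : i + 2 - 1 = i + 1 := by ring
    have i₄ : i + 2 + 1 = i + 3 := by ring
    rcases hcomp with ⟨hlow, hhigh⟩ | ⟨hlow, hhigh⟩ <;> have low₁ := hlow (i + 1) <;>
      have low₂ := hlow (i + 2) <;> have high₁ := hhigh (i + 1) <;>
      have high₂ := hhigh (i + 2) <;> rw [i₁, i₂] at low₁ high₁ <;>
      rw [i₃, i₄] at low₂ high₂ <;> rcases Int.even_or_odd i with hi | hi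
    · exact down (high₁ hi.add_one) (low₂ (hi.add even_two))
    · exact up (low₁ hi.add_one) (high₂ (hi.add_even even_two))
    · exact up (low₁ hi.add_one) (high₂ (hi.add even_two))
    · exact down (high₁ hi.add_one) (low₂ (hi.add_even even_two))
  have hsix : ∑ i ∈ Finset.range 6, edgeLen ρ n (x (i : ℤ)) (x ((i : ℤ) + 1)) ≤
      spindleLength ρ n k x :=
    Finset.sum_le_sum_of_subset_of_nonneg (Finset.range_mono (by omega))
      fun _ _ _ => edgeLen_nonneg _ _ _ _
  have h₀ := key 0
  have h₃ := key 3
  norm_num [Finset.sum_range_succ] at hsix h₀ h₃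
  linarith
end

section
/- For all positive real numbers i, j, k, the identity arccos √( (i·k) / ((i+j)·(j+k)) ) + arccos √( (j·k) / ((i+j)·(i+k)) ) + arccos √( (i·j) / ((i+k)·(j+k)) ) = π holds. (These three terms are the orthoscheme edge lengths along the path A → A∪B → B → B∪C in the diagonal link of a boolean lattice, where A, B, C are disjoint blocks of sizes i, j, k; the identity says that this three-edge path between the antipodal vertices corresponding to the complementary sets A and B∪C has total length exactly π.) -/
theorem sqrt_mul_sqrt_eq_mul_sqrt {a b m c : ℝ} (ha : 0 ≤ a) (hm : 0 ≤ m)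
    (h : a * b = m ^ 2 * c) : √a * √b = m * √c := by
  rw [← Real.sqrt_mul ha, h, Real.sqrt_mul (sq_nonneg m), Real.sqrt_sq hm]

/-- For all positive reals `i`, `j`, `k`, the three orthoscheme edge lengths along the
path `A → A∪B → B → B∪C` in the diagonal link of a boolean lattice with disjoint
blocks `A`, `B`, `C` of sizes `i`, `j`, `k` sum to exactly `π`. -/
theorem arccos_path_eq_pi (i j k : ℝ) (hi : 0 < i) (hj : 0 < j) (hk : 0 < k) :
    Real.arccos (Real.sqrt ((i * k) / ((i + j) * (j + k)))) +
    Real.arccos (Real.sqrt ((j * k) / ((i + j) * (i + k)))) +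
    Real.arccos (Real.sqrt ((i * j) / ((i + k) * (j + k)))) = Real.pi := by
  have hx : 0 ≤ i * k / ((i + j) * (j + k)) := by positivity
  have hy : 0 ≤ j * k / ((i + j) * (i + k)) := by positivity
  have hx' : 1 - i * k / ((i + j) * (j + k)) = j * (i + j + k) / ((i + j) * (j + k)) := by
    field_simp
    ring
  have hy' : 1 - j * k / ((i + j) * (i + k)) = i * (i + j + k) / ((i + j) * (i + k)) := by
    field_simp
    ring
  have hx1 : i * k / ((i + j) * (j + k)) ≤ 1 := by
    rw [← sub_nonneg, hx']
    positivity
  have hy1 : j * k / ((i + j) * (i + k)) ≤ 1 := by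
    rw [← sub_nonneg, hy']
    positivity
  have hcos : Real.cos (Real.arccos √(i * k / ((i + j) * (j + k))) +
      Real.arccos √(j * k / ((i + j) * (i + k)))) = -√(i * j / ((i + k) * (j + k))) := by
    rw [Real.cos_add, Real.sin_arccos, Real.sin_arccos, Real.sq_sqrt hx, Real.sq_sqrt hy,
      Real.cos_arccos (by linarith [Real.sqrt_nonneg (i * k / ((i + j) * (j + k)))])
        (Real.sqrt_le_one.mpr hx1),
      Real.cos_arccos (by linarith [Real.sqrt_nonneg (j * k / ((i + j) * (i + k)))])
        (Real.sqrt_le_one.mpr hy1), hx', hy',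
      sqrt_mul_sqrt_eq_mul_sqrt (m := k / (i + j)) (c := i * j / ((i + k) * (j + k))) hx
        (by positivity) (by field_simp),
      sqrt_mul_sqrt_eq_mul_sqrt (m := (i + j + k) / (i + j))
        (c := i * j / ((i + k) * (j + k))) (by positivity) (by positivity) (by field_simp)]
    field_simp
    ring
  have hsum := Real.arccos_cos
    (add_nonneg (Real.arccos_nonneg √(i * k / ((i + j) * (j + k))))
      (Real.arccos_nonneg √(j * k / ((i + j) * (i + k)))))
    (by linarith [Real.arccos_le_pi_div_two.mpr (Real.sqrt_nonneg (i * k / ((i + j) * (j + k)))),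
      Real.arccos_le_pi_div_two.mpr (Real.sqrt_nonneg (j * k / ((i + j) * (i + k))))])
  rw [hcos, Real.arccos_neg] at hsum
  linarith
end

section
/- Let n ≥ 1 and let C be a chain (a set of pairwise comparable elements) in the poset NC_n of noncrossing partitions of Fin n. Then there exists an order embedding f from the boolean lattice of subsets of Fin (n−1) into NC_n (i.e. f is injective and A ⊆ B ⟺ f(A) ≤ f(B)) such that f(∅) is the discrete partition, f of the full set is the partition with a single block, and every element of C lies in the image of f. In other words, every chain in NC_n belongs to a boolean subposet of rank n − 1. -/
/-- A partition (setoid) of `Fin n` is noncrossing if there are no indices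
`a < b < c < d` with `a ~ c` and `b ~ d` but `a ≁ b`. -/
def IsNoncrossing {n : ℕ} (s : Setoid (Fin n)) : Prop :=
  ∀ a b c d : Fin n, a < b → b < c → c < d → s.r a c → s.r b d → s.r a b

/-- The poset `NC n` of noncrossing partitions of `Fin n`, ordered by refinement. -/
def NC (n : ℕ) : Type := {s : Setoid (Fin n) // IsNoncrossing s}

noncomputable instance (n : ℕ) : PartialOrder (NC n) :=
  Subtype.partialOrder _

/-- The discrete partition (equality), the bottom of `NC n`. -/
def ncBot (n : ℕ) : NC n :=
  ⟨⟨Eq, eq_equivalence⟩, by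
    intro a b c d hab hbc _ hac _
    exact absurd (hab.trans hbc) (by rw [show a = c from hac]; exact lt_irrefl c)⟩

/-- The partition with a single block, the top of `NC n`. -/
def ncTop (n : ℕ) : NC n :=
  ⟨⟨fun _ _ => True, ⟨fun _ => trivial, fun _ => trivial, fun _ _ => trivial⟩⟩,
    fun _ _ _ _ _ _ _ _ _ => trivial⟩

/-- The root of `m` in the forest on `Fin n` whose edges join `p x` to `x`
for those `x ∈ S` with `p x < x`. -/
noncomputable def forestRoot {n : ℕ} (p : Fin n → Fin n) (S : Set (Fin n)) (m : Fin n) : Fin n :=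
  open Classical in if _h : m ∈ S ∧ p m < m then forestRoot p S (p m) else m
termination_by m.val
decreasing_by exact _h.2

section Forest

variable {n : ℕ} {p : Fin n → Fin n} {S : Set (Fin n)}

theorem forestRoot_of_mem {m : Fin n} (hm : m ∈ S) (hp : p m < m) :
    forestRoot p S m = forestRoot p S (p m) := by
  rw [forestRoot, dif_pos ⟨hm, hp⟩]

theorem forestRoot_of_notMem {m : Fin n} (hm : m ∉ S) : forestRoot p S m = m := by
  rw [forestRoot, dif_neg fun h => hm h.1]

theorem forestRoot_le (m : Fin n) : forestRoot p S m ≤ m := by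
  induction m using WellFoundedLT.induction with
  | ind m ih =>
    rw [forestRoot]
    split_ifs with h
    · exact (ih _ h.2).trans h.2.le
    · exact le_rfl

theorem mem_of_forestRoot_eq {x y : Fin n} (hxy : x < y)
    (h : forestRoot p S x = forestRoot p S y) : y ∈ S := by
  by_contra hy
  rw [forestRoot_of_notMem hy] at h
  exact absurd (forestRoot_le (p := p) (S := S) x) (by rw [h]; exact not_le.mpr hxy)

/-- If no two edges of the forest cross, then its components form a noncrossing partition. -/
theorem isNoncrossing_ker_forestRoot (hp : ∀ m ∈ S, p m < m)
    (hcross : ∀ x ∈ S, ∀ y ∈ S, p x < p y → p y < x → ¬ x < y) :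
    IsNoncrossing (Setoid.ker (forestRoot p S)) := by
  have step : ∀ x y, x < y → forestRoot p S x = forestRoot p S y →
      y ∈ S ∧ p y < y ∧ forestRoot p S y = forestRoot p S (p y) := fun x y hxy h => by
    have hy := mem_of_forestRoot_eq hxy h
    exact ⟨hy, hp y hy, forestRoot_of_mem hy (hp y hy)⟩
  suffices H : ∀ N : ℕ, ∀ a b c d : Fin n, a.val + b.val + c.val + d.val = N →
      a < b → b < c → c < d → forestRoot p S a = forestRoot p S c →
      forestRoot p S b = forestRoot p S d → forestRoot p S a = forestRoot p S b from
    fun a b c d hab hbc hcd hac hbd => H _ a b c d rfl hab hbc hcd hac hbd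
  intro N
  induction N using Nat.strong_induction_on with
  | _ N ih =>
    intro a b c d hN hab hbc hcd hac hbd
    obtain ⟨hd, hdlt, hdr⟩ := step b d (hbc.trans hcd) hbd
    obtain ⟨hc, hclt, hcr⟩ := step a c (hab.trans hbc) hac
    rcases lt_trichotomy c (p d) with hq | hq | hq
    · exact ih _ (by omega) a b c (p d) rfl hab hbc hq hac (hbd.trans hdr)
    · rw [hac, hbd, hdr, hq]
    rcases lt_trichotomy (p c) (p d) with hs | hs | hs
    · exact absurd hcd (hcross c hc d hd hs hq)
    · rw [hac, hcr, hs, hbd, hdr]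
    rcases lt_trichotomy b (p c) with hb | hb | hb
    · exact ih _ (by omega) a b (p c) d rfl hab hb (hclt.trans hcd) (hac.trans hcr) hbd
    · rw [hac, hcr, hb]
    obtain ⟨hbS, hblt, hbr⟩ := step (p d) b (hs.trans hb) (hdr.symm.trans hbd.symm)
    rcases lt_trichotomy (p b) (p c) with hu | hu | hu
    · exact absurd hbc (hcross b hbS c hc hu hb)
    · rw [hac, hcr, hbr, hu]
    rcases lt_trichotomy a (p b) with ha | ha | ha
    · rw [hbr]
      exact ih _ (by omega) a (p b) c d rfl ha (hblt.trans hbc) hcd hac (hbr.symm.trans hbd)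
    · rw [hbr, ha]
    obtain ⟨haS, halt, har⟩ := step (p c) a (hu.trans ha) (hcr.symm.trans hac.symm)
    rcases lt_trichotomy (p a) (p b) with hv | hv | hv
    · exact absurd hab (hcross a haS b hbS hv ha)
    · rw [har, hbr, hv]
    · rw [har]
      exact ih _ (by omega) (p a) b c d rfl (halt.trans hab) hbc hcd (har.symm.trans hac) hbd

/-- A partition is recovered from the forest on its non-minimal elements. -/
theorem ker_forestRoot_eq {s : Setoid (Fin n)} (hS : ∀ m, m ∈ S ↔ ∃ x < m, s.r x m)
    (hp : ∀ m ∈ S, p m < m ∧ s.r (p m) m) : Setoid.ker (forestRoot p S) = s := by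
  have hroot : ∀ m, s.r (forestRoot p S m) m := fun m => by
    induction m using WellFoundedLT.induction with
    | ind m ih =>
      by_cases hm : m ∈ S
      · rw [forestRoot_of_mem hm (hp m hm).1]
        exact s.trans (ih _ (hp m hm).1) (hp m hm).2
      · rw [forestRoot_of_notMem hm]
  have hmin : ∀ m, forestRoot p S m ∉ S := fun m => by
    induction m using WellFoundedLT.induction with
    | ind m ih =>
      by_cases hm : m ∈ S
      · rw [forestRoot_of_mem hm (hp m hm).1]
        exact ih _ (hp m hm).1
      · rwa [forestRoot_of_notMem hm]
  ext x y
  constructor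
  · intro h
    have h : forestRoot p S x = forestRoot p S y := h
    exact s.trans (s.symm (hroot x)) (h ▸ hroot y)
  · intro h
    have hr : s.r (forestRoot p S x) (forestRoot p S y) :=
      s.trans (hroot x) (s.trans h (s.symm (hroot y)))
    change forestRoot p S x = forestRoot p S y
    rcases lt_trichotomy (forestRoot p S x) (forestRoot p S y) with h | h | h
    · exact absurd ((hS _).2 ⟨_, h, hr⟩) (hmin y)
    · exact h
    · exact absurd ((hS _).2 ⟨_, h, s.symm hr⟩) (hmin x)

theorem ker_forestRoot_le_iff {T : Set (Fin n)} (hS : ∀ m ∈ S, p m < m) :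
    Setoid.ker (forestRoot p S) ≤ Setoid.ker (forestRoot p T) ↔ S ⊆ T := by
  constructor
  · intro h m hm
    exact mem_of_forestRoot_eq (hS m hm) (h (forestRoot_of_mem hm (hS m hm)).symm)
  · intro h
    have key : ∀ m, forestRoot p T (forestRoot p S m) = forestRoot p T m := fun m => by
      induction m using WellFoundedLT.induction with
      | ind m ih =>
        by_cases hm : m ∈ S
        · rw [forestRoot_of_mem hm (hS m hm), ih _ (hS m hm),
            ← forestRoot_of_mem (h hm) (hS m hm)]
        · rw [forestRoot_of_notMem hm]
    intro x y hxy
    have hxy : forestRoot p S x = forestRoot p S y := hxy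
    change forestRoot p T x = forestRoot p T y
    rw [← key x, hxy, key y]

end Forest

instance {n : ℕ} : Finite (NC n) :=
  Finite.of_injective (fun c : NC n => c.1.r) fun _ _ h =>
    Subtype.ext (Setoid.ext fun x y => iff_of_eq (congrFun (congrFun h x) y))

/-- The least member of the chain in which `m > 0` is not the minimum of its block, together
with the predecessor of `m` in that block. -/
theorem exists_least_predecessor {k : ℕ} {C : Set (NC (k + 1))} (hC : IsChain (· ≤ ·) C)
    (htop : ncTop (k + 1) ∈ C) {m : Fin (k + 1)} (hm : 0 < m) :
    ∃ q < m, ∃ t ∈ C, t.1.r q m ∧ (∀ x < m, t.1.r x m → x ≤ q) ∧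
      ∀ c ∈ C, (∃ x < m, c.1.r x m) → t ≤ c := by
  obtain ⟨t, ht⟩ := (Set.toFinite {c | c ∈ C ∧ ∃ x < m, c.1.r x m}).exists_minimal
    ⟨ncTop (k + 1), htop, 0, hm, trivial⟩
  obtain ⟨htC, htm⟩ := ht.prop
  obtain ⟨q, hq⟩ := (Set.toFinite {x | x < m ∧ t.1.r x m}).exists_maximal htm
  refine ⟨q, hq.prop.1, t, htC, hq.prop.2, fun x hx hxm => ?_, fun c hc hcm => ?_⟩
  · exact (le_total x q).elim id fun h => hq.le_of_ge ⟨hx, hxm⟩ h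
  · exact (hC.total htC hc).elim id fun h => ht.le_of_le ⟨hc, hcm⟩ h

/-- A chain containing the top is carried by a single noncrossing tree. -/
theorem exists_noncrossing_tree {k : ℕ} {C : Set (NC (k + 1))} (hC : IsChain (· ≤ ·) C)
    (htop : ncTop (k + 1) ∈ C) :
    ∃ p : Fin (k + 1) → Fin (k + 1), (∀ m, 0 < m → p m < m) ∧
      (∀ x, 0 < x → ∀ y, 0 < y → p x < p y → p y < x → ¬ x < y) ∧
      ∀ c ∈ C, ∀ m, (∃ x < m, c.1.r x m) → c.1.r (p m) m := by
  have hex : ∀ m : Fin (k + 1), ∃ q, 0 < m → q < m ∧ ∃ t ∈ C, t.1.r q m ∧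
      (∀ x < m, t.1.r x m → x ≤ q) ∧ ∀ c ∈ C, (∃ x < m, c.1.r x m) → t ≤ c := fun m => by
    by_cases hm : 0 < m
    · obtain ⟨q, h⟩ := exists_least_predecessor hC htop hm
      exact ⟨q, fun _ => h⟩
    · exact ⟨m, fun h => absurd h hm⟩
  choose p hp using hex
  refine ⟨p, fun m hm => (hp m hm).1, fun x hx y hy h₁ h₂ h₃ => ?_, fun c hc m hm => ?_⟩
  · obtain ⟨-, t, htC, htx, htmax, -⟩ := hp x hx
    obtain ⟨-, u, huC, huy, humax, -⟩ := hp y hy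
    rcases hC.total htC huC with h | h
    · have hux : u.1.r (p x) x := h htx
      have hu := u.2 _ _ _ _ h₁ h₂ h₃ hux huy
      exact absurd (humax x h₃ (u.1.trans (u.1.symm hux) (u.1.trans hu huy))) (not_le.mpr h₂)
    · have hty : t.1.r (p y) y := h huy
      have ht := t.2 _ _ _ _ h₁ h₂ h₃ htx hty
      exact absurd (htmax (p y) h₂ (t.1.trans (t.1.symm ht) htx)) (not_le.mpr h₁)
  · obtain ⟨x, hx, -⟩ := id hm
    obtain ⟨-, t, -, htm, -, hleast⟩ := hp m ((Fin.zero_le x).trans_lt hx)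
    exact hleast c hc hm htm

theorem ncBot_le {n : ℕ} (c : NC n) : ncBot n ≤ c := by
  intro x y hxy
  have hxy : x = y := hxy
  exact hxy ▸ c.1.refl x

theorem le_ncTop {n : ℕ} (c : NC n) : c ≤ ncTop n := fun _ _ _ => trivial

/-- Every chain in the poset `NC n` of noncrossing partitions of `Fin n` belongs to a
boolean subposet of rank `n − 1`: there is an order embedding `f` of the boolean
lattice of subsets of `Fin (n − 1)` into `NC n` sending `∅` to the discrete partition
and the full set to the single-block partition, whose image contains the chain. -/
theorem chain_in_boolean_subposet (n : ℕ) (hn : 1 ≤ n) (C : Set (NC n))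
    (hC : IsChain (· ≤ ·) C) :
    ∃ f : Finset (Fin (n - 1)) → NC n,
      Function.Injective f ∧
      (∀ A B : Finset (Fin (n - 1)), A ⊆ B ↔ f A ≤ f B) ∧
      f ∅ = ncBot n ∧
      f Finset.univ = ncTop n ∧
      ∀ c ∈ C, c ∈ Set.range f := by
  classical
  obtain ⟨k, rfl⟩ : ∃ k, n = k + 1 := ⟨n - 1, by omega⟩
  change ∃ f : Finset (Fin k) → NC (k + 1),
      Function.Injective f ∧
      (∀ A B : Finset (Fin k), A ⊆ B ↔ f A ≤ f B) ∧
      f ∅ = ncBot (k + 1) ∧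
      f Finset.univ = ncTop (k + 1) ∧
      ∀ c ∈ C, c ∈ Set.range f
  have hC' : IsChain (· ≤ ·) (insert (ncBot (k + 1)) (insert (ncTop (k + 1)) C)) :=
    (hC.insert fun c _ _ => Or.inr (le_ncTop c)).insert fun c _ _ => Or.inl (ncBot_le c)
  obtain ⟨p, hlt, hcross, hrel⟩ := exists_noncrossing_tree hC' (by simp)
  have hpos : ∀ A : Finset (Fin k), ∀ m ∈ Fin.succ '' (A : Set (Fin k)), 0 < m := by
    rintro A _ ⟨i, -, rfl⟩
    exact Fin.succ_pos i
  have hltA : ∀ A : Finset (Fin k), ∀ m ∈ Fin.succ '' (A : Set (Fin k)), p m < m :=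
    fun A m hm => hlt m (hpos A m hm)
  let f : Finset (Fin k) → NC (k + 1) := fun A =>
    ⟨Setoid.ker (forestRoot p (Fin.succ '' (A : Set (Fin k)))),
      isNoncrossing_ker_forestRoot (hltA A) fun x hx y hy =>
        hcross x (hpos A x hx) y (hpos A y hy)⟩
  have hf : ∀ A B, A ⊆ B ↔ f A ≤ f B := fun A B => by
    change _ ↔ Setoid.ker _ ≤ Setoid.ker _
    rw [ker_forestRoot_le_iff (hltA A),
      Set.image_subset_image_iff (Fin.succ_injective k), Finset.coe_subset]
  have hrange : ∀ c ∈ insert (ncBot (k + 1)) (insert (ncTop (k + 1)) C), c ∈ Set.range f := by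
    intro c hc
    refine ⟨Finset.univ.filter fun i : Fin k => ∃ x < i.succ, c.1.r x i.succ, Subtype.ext ?_⟩
    have hmem : ∀ m, m ∈ Fin.succ '' ((Finset.univ.filter fun i : Fin k =>
        ∃ x < i.succ, c.1.r x i.succ : Finset (Fin k)) : Set (Fin k)) ↔
        ∃ x < m, c.1.r x m := fun m => by
      refine ⟨?_, fun hm => ?_⟩
      · rintro ⟨i, hi, rfl⟩
        exact (Finset.mem_filter.1 hi).2
      · obtain ⟨x, hx, -⟩ := id hm
        obtain ⟨i, rfl⟩ := Fin.exists_succ_eq.2 ((Fin.zero_le x).trans_lt hx).ne'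
        exact ⟨i, Finset.mem_filter.2 ⟨Finset.mem_univ i, hm⟩, rfl⟩
    exact ker_forestRoot_eq hmem fun m hm => ⟨hltA _ m hm, hrel c hc m ((hmem m).1 hm)⟩
  refine ⟨f, fun A B h => ?_, hf, ?_, ?_, fun c hc => hrange c (by simp [hc])⟩
  · exact ((hf A B).2 h.le).antisymm ((hf B A).2 h.ge)
  · obtain ⟨A, hA⟩ := hrange (ncBot (k + 1)) (by simp)
    exact (hA ▸ (hf ∅ A).1 A.empty_subset).antisymm (ncBot_le _)
  · obtain ⟨A, hA⟩ := hrange (ncTop (k + 1)) (by simp)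
    exact (le_ncTop _).antisymm (hA ▸ (hf A Finset.univ).1 A.subset_univ)
end

section
/- Let u_1, …, u_n be pairwise orthogonal nonzero vectors in a real inner product space, let v_0 = 0 and v_k = u_1 + ⋯ + u_k for 1 ≤ k ≤ n. Then every nonzero point x in the convex hull of {v_0, v_1, …, v_n} satisfies ⟪x, v_n⟫ > 0. (This says the link of the endpoint v_0 in the orthoscheme ortho(v_0, …, v_n) lies in the open hemisphere whose pole is the direction of the diagonal from v_0 to v_n, which is the key step in showing endpoint links are monotonically contractible.) -/
open scoped RealInnerProductSpace

/-- The inner product of a partial sum of pairwise orthogonal vectors with a larger partial sum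
is the squared norm of the smaller one. -/
theorem inner_sum_sum_eq_norm_sq_of_subset {ι V : Type*} [NormedAddCommGroup V]
    [InnerProductSpace ℝ V] {u : ι → V} (horth : ∀ i j, i ≠ j → ⟪u i, u j⟫ = 0)
    {s t : Finset ι} (hst : s ⊆ t) :
    ⟪∑ i ∈ s, u i, ∑ i ∈ t, u i⟫ = ‖∑ i ∈ s, u i‖ ^ 2 := by
  classical
  have h : ⟪∑ i ∈ s, u i, ∑ i ∈ t \ s, u i⟫ = 0 := by
    rw [sum_inner]
    refine Finset.sum_eq_zero fun i hi => ?_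
    rw [inner_sum]
    refine Finset.sum_eq_zero fun j hj => horth i j ?_
    rintro rfl
    exact (Finset.mem_sdiff.mp hj).2 hi
  rw [← Finset.sum_sdiff hst, inner_add_right, h, zero_add, real_inner_self_eq_norm_sq]

/-- An open half-space bounded by a hyperplane through the origin remains convex when the origin
is added to it. -/
theorem convex_eq_zero_or_inner_pos {V : Type*} [NormedAddCommGroup V] [InnerProductSpace ℝ V]
    (w : V) : Convex ℝ {y : V | y = 0 ∨ 0 < ⟪y, w⟫} := by
  refine convex_iff_forall_pos.mpr ?_
  rintro y hy z hz a b ha hb -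
  rcases hy with rfl | hy <;> rcases hz with rfl | hz
  · simp
  · right
    simpa [real_inner_smul_left] using mul_pos hb hz
  · right
    simpa [real_inner_smul_left] using mul_pos ha hy
  · right
    rw [inner_add_left, real_inner_smul_left, real_inner_smul_left]
    positivity

/-- In an orthoscheme `ortho(v 0, …, v n)` built from pairwise orthogonal nonzero
vectors `u 1, …, u n` (with `v 0 = 0` and `v k = u 1 + ⋯ + u k`), every nonzero point
`x` of the convex hull of the vertices satisfies `⟪x, v n⟫ > 0`: the link of the
endpoint `v 0` lies in the open hemisphere whose pole is the direction of the
diagonal. -/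
theorem orthoscheme_endpoint_link_in_hemisphere
    {V : Type*} [NormedAddCommGroup V] [InnerProductSpace ℝ V]
    (n : ℕ) (u : Fin n → V) (hu : ∀ i, u i ≠ 0)
    (horth : ∀ i j, i ≠ j → ⟪u i, u j⟫ = 0)
    (v : Fin (n + 1) → V)
    (hv : ∀ k : Fin (n + 1), v k = ∑ i ∈ Finset.univ.filter (fun i : Fin n => (i : ℕ) < (k : ℕ)), u i)
    (x : V) (hx : x ∈ convexHull ℝ (Set.range v)) (hx0 : x ≠ 0) :
    0 < ⟪x, v (Fin.last n)⟫ := by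
  have hsub : Set.range v ⊆ {y : V | y = 0 ∨ 0 < ⟪y, v (Fin.last n)⟫} := by
    rintro _ ⟨k, rfl⟩
    have h : ⟪v k, v (Fin.last n)⟫ = ‖v k‖ ^ 2 := by
      rw [hv k, hv (Fin.last n)]
      refine inner_sum_sum_eq_norm_sq_of_subset horth fun i _ => ?_
      simp
    rcases eq_or_ne (v k) 0 with h0 | h0
    · exact Or.inl h0
    · right
      rw [h]
      positivity
  exact (convexHull_min hsub (convex_eq_zero_or_inner_pos _) hx).resolve_left hx0
end
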